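/- Let f: ℝⁿ → ℝ be continuously differentiable and let sequences {x^k}, {g^k}, {d^k}, {ε_k}, {r_k}, {ρ_k}, {t_k} follow the IRG scheme with backtracking stepsizes and with θ < μ. Assume ρ_k → 0 as k → ∞, that x̄ is an accumulation point of {x^k}, and that f satisfies the KL property at x̄. Then x̄ is a stationary point of f and the whole sequence {x^k} converges to x̄. -/

import Mathlib

open Filter

/-- The general IRG scheme (Algorithm 1): inexact gradients `g^k` with automatically
controlled errors `ε_k` (and manual errors `ρ_k`), radius updates with factors
`μ, θ ∈ (0,1)`, reduced directions `d^k`, and iterations `x^{k+1} = x^k + t_k d^k`. -/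
def IRGScheme {n : ℕ} (f : EuclideanSpace ℝ (Fin n) → ℝ)
    (x g d : ℕ → EuclideanSpace ℝ (Fin n)) (ε r ρ t : ℕ → ℝ) (μ θ : ℝ) : Prop :=
  (0 < μ ∧ μ < 1) ∧ (0 < θ ∧ θ < 1) ∧
  (∀ k, 0 < ε k) ∧ (∀ k, 0 < r k) ∧ (∀ k, 0 < ρ k) ∧ (∀ k, 0 < t k) ∧
  (∀ k, ‖g k - gradient f (x k)‖ ≤ min (ε k) (ρ k)) ∧
  (∀ k, ‖g k‖ ≤ r k + ε k →
    r (k + 1) = μ * r k ∧ ε (k + 1) = θ * ε k ∧ d k = 0) ∧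
  (∀ k, r k + ε k < ‖g k‖ →
    r (k + 1) = r k ∧ ε (k + 1) = ε k ∧
      d k = -(((‖g k‖ - ε k) / ‖g k‖) • g k)) ∧
  (∀ k, x (k + 1) = x k + t k • d k)

/-- Backtracking stepsize selection: `t_k = τ` on null iterations, and otherwise
`t_k = γ^{m_k}` with `m_k` the smallest nonnegative integer satisfying the linesearch
condition `f(x^k + γ^m d^k) ≤ f(x^k) - β γ^m ‖d^k‖²`. -/
def BacktrackingStepsize {n : ℕ} (f : EuclideanSpace ℝ (Fin n) → ℝ)
    (x d : ℕ → EuclideanSpace ℝ (Fin n)) (t : ℕ → ℝ) (β γ τ : ℝ) : Prop :=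
  (0 < β ∧ β < 1) ∧ (0 < γ ∧ γ < 1) ∧ (0 < τ ∧ τ < 1) ∧
  (∀ k, d k = 0 → t k = τ) ∧
  (∀ k, d k ≠ 0 → ∃ m : ℕ,
    t k = γ ^ m ∧
    f (x k + γ ^ m • d k) ≤ f (x k) - β * γ ^ m * ‖d k‖ ^ 2 ∧
    ∀ j < m, ¬ f (x k + γ ^ j • d k) ≤ f (x k) - β * γ ^ j * ‖d k‖ ^ 2)

/-- The Kurdyka–Łojasiewicz property of `f` at `xbar` (Definition 2.2): there are
`η > 0`, a neighborhood `U` of `xbar`, and a nondecreasing function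
`ψ : (0, η) → (0, ∞)` with `1/ψ` integrable over `(0, η)` such that
`‖∇f(y)‖ ≥ ψ(f(y) - f(xbar))` whenever `y ∈ U` and `f(xbar) < f(y) < f(xbar) + η`. -/
def KLProperty {n : ℕ} (f : EuclideanSpace ℝ (Fin n) → ℝ)
    (xbar : EuclideanSpace ℝ (Fin n)) : Prop :=
  ∃ η > (0 : ℝ), ∃ U ∈ nhds xbar, ∃ ψ : ℝ → ℝ,
    (∀ s ∈ Set.Ioo (0 : ℝ) η, 0 < ψ s) ∧
    MonotoneOn ψ (Set.Ioo (0 : ℝ) η) ∧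
    MeasureTheory.IntegrableOn (fun s => 1 / ψ s) (Set.Ioo (0 : ℝ) η) ∧
    ∀ y ∈ U, f xbar < f y → f y < f xbar + η → ψ (f y - f xbar) ≤ ‖gradient f y‖

/-- A desingularizing function for a nondecreasing `ψ` with `1 / ψ` integrable: a primitive
of `1 / ψ`. -/
lemma exists_desingularizing {η : ℝ} {ψ : ℝ → ℝ} (hpos : ∀ s ∈ Set.Ioo (0 : ℝ) η, 0 < ψ s)
    (hmono : MonotoneOn ψ (Set.Ioo (0 : ℝ) η))
    (hint : MeasureTheory.IntegrableOn (fun s => 1 / ψ s) (Set.Ioo (0 : ℝ) η)) :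
    ∃ φ : ℝ → ℝ, Continuous φ ∧ φ 0 = 0 ∧ (∀ a, 0 ≤ a → 0 ≤ φ a) ∧
      ∀ a b, 0 < a → a ≤ b → b < η → (b - a) / ψ b ≤ φ b - φ a := by
  set h : ℝ → ℝ := (Set.Ioo (0 : ℝ) η).indicator fun s => 1 / ψ s with hh
  have hI : MeasureTheory.Integrable h :=
    (MeasureTheory.integrable_indicator_iff measurableSet_Ioo).2 hint
  have hii : ∀ a b, IntervalIntegrable h MeasureTheory.volume a b :=
    fun a b => hI.intervalIntegrable
  refine ⟨fun s => ∫ u in (0 : ℝ)..s, h u, hI.continuous_primitive 0,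
    intervalIntegral.integral_same, fun a ha => ?_, fun a b ha hab hb => ?_⟩
  · exact intervalIntegral.integral_nonneg_of_forall ha fun u =>
      Set.indicator_nonneg (fun s hs => (one_div_pos.2 (hpos s hs)).le) u
  · rw [intervalIntegral.integral_interval_sub_left (hii _ _) (hii _ _)]
    have hle : ∫ _ in a..b, 1 / ψ b ≤ ∫ u in a..b, h u := by
      refine intervalIntegral.integral_mono_on hab (by simp) (hii _ _) fun u hu => ?_
      have hu' : u ∈ Set.Ioo (0 : ℝ) η := ⟨ha.trans_le hu.1, hu.2.trans_lt hb⟩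
      have hb' : b ∈ Set.Ioo (0 : ℝ) η := ⟨ha.trans_le hab, hb⟩
      rw [hh, Set.indicator_of_mem hu']
      exact one_div_le_one_div_of_le (hpos u hu') (hmono hu' hb' hu.2)
    rw [intervalIntegral.integral_const, smul_eq_mul] at hle
    rwa [div_eq_mul_one_div]

/-- Convergence of a descent sequence under the Kurdyka–Łojasiewicz inequality, in terms of
the positive gaps `Δ k` of the function values and the gradient norms `G k`. -/
lemma tendsto_of_kl_of_descent {E : Type*} [NormedAddCommGroup E] {x : ℕ → E} {xbar : E}
    {Δ G : ℕ → ℝ} {η δ σ : ℝ} {ψ : ℝ → ℝ} (hη : 0 < η) (hδ : 0 < δ) (hσ : 0 < σ)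
    (hpos : ∀ s ∈ Set.Ioo (0 : ℝ) η, 0 < ψ s)
    (hmono : MonotoneOn ψ (Set.Ioo (0 : ℝ) η))
    (hint : MeasureTheory.IntegrableOn (fun s => 1 / ψ s) (Set.Ioo (0 : ℝ) η))
    (hΔpos : ∀ k, 0 < Δ k) (hΔanti : Antitone Δ) (hΔlim : Tendsto Δ atTop (nhds 0))
    (hKL : ∀ k, dist (x k) xbar < δ → Δ k < η → ψ (Δ k) ≤ G k)
    (hdesc : ∀ᶠ k in atTop, σ * G k * ‖x (k + 1) - x k‖ ≤ Δ k - Δ (k + 1))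
    {κ : ℕ → ℕ} (hκ : StrictMono κ) (hacc : Tendsto (x ∘ κ) atTop (nhds xbar)) :
    Tendsto x atTop (nhds xbar) := by
  obtain ⟨φ, hφc, hφ0, hφnn, hφ⟩ := exists_desingularizing hpos hmono hint
  have hφΔ : Tendsto (fun k => φ (Δ k)) atTop (nhds 0) := by
    simpa [hφ0, Function.comp_def] using (hφc.tendsto 0).comp hΔlim
  rw [Metric.tendsto_atTop]
  intro e he
  set e' := min e δ
  have he'0 : 0 < e' := lt_min he hδ
  have hev : ∀ᶠ k in atTop, φ (Δ k) < σ * (e' / 2) ∧ Δ k < η ∧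
      ∀ l ≥ k, σ * G l * ‖x (l + 1) - x l‖ ≤ Δ l - Δ (l + 1) :=
    (hφΔ.eventually_lt_const (by positivity)).and
      ((hΔlim.eventually_lt_const hη).and (eventually_forall_ge_atTop.2 hdesc))
  obtain ⟨j, ⟨hj1, hj2, hj3⟩, hj4⟩ := ((hκ.tendsto_atTop.eventually hev).and
    (hacc.eventually (Metric.ball_mem_nhds xbar (half_pos he'0)))).exists
  change dist (x (κ j)) xbar < e' / 2 at hj4
  set k₀ := κ j
  have hball : ∀ k, σ * dist (x k) (x k₀) ≤ φ (Δ k₀) - φ (Δ k) → dist (x k) xbar < e' := by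
    intro k hk
    have h1 : dist (x k) (x k₀) < e' / 2 := by
      refine lt_of_mul_lt_mul_left ?_ hσ.le
      linarith [hφnn _ (hΔpos k).le]
    linarith [dist_triangle (x k) (x k₀) xbar]
  have hlen : ∀ k ≥ k₀, σ * dist (x k) (x k₀) ≤ φ (Δ k₀) - φ (Δ k) := by
    intro k hk
    induction k, hk using Nat.le_induction with
    | base => simp
    | succ k hk ih =>
      have hΔk : Δ k < η := (hΔanti hk).trans_lt hj2
      have hψ : 0 < ψ (Δ k) := hpos _ ⟨hΔpos k, hΔk⟩
      have hG := hKL k ((hball k ih).trans_le (min_le_right _ _)) hΔk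
      have hstep : σ * ‖x (k + 1) - x k‖ ≤ (Δ k - Δ (k + 1)) / ψ (Δ k) := by
        rw [le_div_iff₀ hψ]
        calc σ * ‖x (k + 1) - x k‖ * ψ (Δ k) ≤ σ * ‖x (k + 1) - x k‖ * G k := by gcongr
          _ = σ * G k * ‖x (k + 1) - x k‖ := by ring
          _ ≤ _ := hj3 k hk
      have hgap := hφ _ _ (hΔpos (k + 1)) (hΔanti k.le_succ) hΔk
      have htri := mul_le_mul_of_nonneg_left (dist_triangle (x (k + 1)) (x k) (x k₀)) hσ.le
      rw [← dist_eq_norm] at hstep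
      linarith
  exact ⟨k₀, fun k hk => (hball k (hlen k hk)).trans_le (min_le_left _ _)⟩

lemma continuous_gradient_of_contDiff {E : Type*} [NormedAddCommGroup E] [InnerProductSpace ℝ E]
    [CompleteSpace E] {f : E → ℝ} (hf : ContDiff ℝ 1 f) : Continuous (gradient f) :=
  (InnerProductSpace.toDual ℝ E).symm.continuous.comp (hf.continuous_fderiv one_ne_zero)

/-- Failure of the sufficient decrease condition along a descent direction forces the gradient
to vary on the segment that is searched. -/
lemma exists_gradient_variation_of_not_decrease {E : Type*} [NormedAddCommGroup E]
    [InnerProductSpace ℝ E] [CompleteSpace E] {f : E → ℝ} (hf : Differentiable ℝ f) {x d : E}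
    {β s : ℝ} (hs : 0 < s) (hd : d ≠ 0) (hdir : inner ℝ (gradient f x) d ≤ -‖d‖ ^ 2)
    (hfail : ¬ f (x + s • d) ≤ f x - β * s * ‖d‖ ^ 2) :
    ∃ z, ‖z - x‖ ≤ s * ‖d‖ ∧ (1 - β) * ‖d‖ ≤ ‖gradient f z - gradient f x‖ := by
  obtain ⟨z, hz, hfz⟩ := domain_mvt (x := x) (y := x + s • d)
    (fun y _ => (hf y).hasFDerivAt.hasFDerivWithinAt) convex_univ trivial trivial
  have hd0 : 0 < ‖d‖ := norm_pos_iff.2 hd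
  refine ⟨z, ?_, ?_⟩
  · simpa [norm_smul, abs_of_pos hs] using norm_sub_le_of_mem_segment hz
  · rw [add_sub_cancel_left, map_smul, smul_eq_mul, ← inner_gradient_left] at hfz
    have h1 : -β * ‖d‖ ^ 2 < inner ℝ (gradient f z) d := by
      refine lt_of_mul_lt_mul_left ?_ hs.le
      linarith
    have h2 := real_inner_le_norm (gradient f z - gradient f x) d
    rw [inner_sub_left] at h2
    refine le_of_mul_le_mul_right ?_ hd0
    linarith

/-- The reduced direction built from an approximation `g` of `G` with error at most `ε < ‖g‖`. -/
lemma reduced_direction_bounds {E : Type*} [NormedAddCommGroup E] [InnerProductSpace ℝ E]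
    {G g d : E} {ε : ℝ} (hε : 0 < ε) (hg : ‖g - G‖ ≤ ε) (hlt : ε < ‖g‖)
    (hd : d = -(((‖g‖ - ε) / ‖g‖) • g)) :
    ‖d‖ = ‖g‖ - ε ∧ inner ℝ G d ≤ -‖d‖ ^ 2 ∧ ‖G‖ ≤ ‖d‖ + 2 * ε := by
  have hg0 : 0 < ‖g‖ := hε.trans hlt
  have hnd : ‖d‖ = ‖g‖ - ε := by
    rw [hd, norm_neg, norm_smul, Real.norm_of_nonneg (div_nonneg (sub_nonneg.2 hlt.le) hg0.le),
      div_mul_cancel₀ _ hg0.ne']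
  have hgd : inner ℝ g d = -(‖d‖ * ‖g‖) := by
    rw [hnd, hd, inner_neg_right, real_inner_smul_right, real_inner_self_eq_norm_sq]
    field_simp
  refine ⟨hnd, ?_, ?_⟩
  · have h1 := real_inner_le_norm (G - g) d
    rw [inner_sub_left, hgd, norm_sub_rev] at h1
    nlinarith [norm_nonneg d]
  · have h1 := norm_le_norm_add_norm_sub g G
    linarith

/-- Along a backtracking descent sequence with an accumulation point and vanishing decrease,
the directions are not bounded away from zero. -/
lemma not_eventually_le_norm_direction {E : Type*} [NormedAddCommGroup E]
    [InnerProductSpace ℝ E] [CompleteSpace E] {f : E → ℝ} (hf : ContDiff ℝ 1 f)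
    {x d : ℕ → E} {t : ℕ → ℝ} {β γ c : ℝ} (hβ : 0 < β) (hβ1 : β < 1) (hγ : 0 < γ) (hc : 0 < c)
    (ht : ∀ k, 0 < t k) (hdir : ∀ k, inner ℝ (gradient f (x k)) (d k) ≤ -‖d k‖ ^ 2)
    (hbt : ∀ k, d k ≠ 0 → ∃ m : ℕ, t k = γ ^ m ∧
      ∀ j < m, ¬ f (x k + γ ^ j • d k) ≤ f (x k) - β * γ ^ j * ‖d k‖ ^ 2)
    (hdec : ∀ k, β * ‖d k‖ * (t k * ‖d k‖) ≤ f (x k) - f (x (k + 1)))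
    (hgap : Tendsto (fun k => f (x k) - f (x (k + 1))) atTop (nhds 0))
    {xbar : E} {κ : ℕ → ℕ} (hκ : StrictMono κ) (hacc : Tendsto (x ∘ κ) atTop (nhds xbar)) :
    ¬ ∀ᶠ k in atTop, c ≤ ‖d k‖ := by
  intro hlow
  have hb : 0 < (1 - β) * c / 2 := by
    have := sub_pos.2 hβ1
    positivity
  obtain ⟨δ, hδ, hcont⟩ := Metric.continuous_iff.1 (continuous_gradient_of_contDiff hf) xbar _ hb
  have hmin : 0 < β * c * min (c / 2) (γ * (δ / 2)) := by positivity
  obtain ⟨j, ⟨hlowj, hsmall⟩, hxj⟩ := ((hκ.tendsto_atTop.eventually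
    (hlow.and (hgap.eventually_lt_const hmin))).and
    (hacc.eventually (Metric.ball_mem_nhds xbar (half_pos hδ)))).exists
  change dist (x (κ j)) xbar < δ / 2 at hxj
  set k := κ j
  have htd : t k * ‖d k‖ < min (c / 2) (γ * (δ / 2)) := by
    have h0 : 0 ≤ t k * ‖d k‖ := mul_nonneg (ht k).le (norm_nonneg _)
    refine lt_of_mul_lt_mul_left (lt_of_le_of_lt ?_ hsmall) (by positivity : 0 ≤ β * c)
    refine le_trans ?_ (hdec k)
    gcongr
  have hdk : d k ≠ 0 := norm_pos_iff.1 (hc.trans_le hlowj)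
  obtain ⟨m, htm, hfail⟩ := hbt k hdk
  obtain _ | m := m
  · have := htd.trans_le (min_le_left _ _)
    rw [htm, pow_zero, one_mul] at this
    linarith
  · obtain ⟨z, hz, hvar⟩ := exists_gradient_variation_of_not_decrease (hf.differentiable one_ne_zero)
      (pow_pos hγ m) hdk (hdir k) (hfail m m.lt_succ_self)
    have hzx : dist z (x k) < δ / 2 := by
      rw [dist_eq_norm]
      refine hz.trans_lt (lt_of_mul_lt_mul_left ?_ hγ.le)
      calc γ * (γ ^ m * ‖d k‖) = t k * ‖d k‖ := by rw [htm]; ring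
        _ < _ := htd.trans_le (min_le_right _ _)
    have h1 := hcont z (by linarith [dist_triangle z (x k) xbar])
    have h2 := hcont (x k) (by linarith)
    have h3 := dist_triangle_right (gradient f z) (gradient f (x k)) (gradient f xbar)
    rw [dist_eq_norm (gradient f z) (gradient f (x k))] at h3
    have h4 : (1 - β) * c ≤ (1 - β) * ‖d k‖ :=
      mul_le_mul_of_nonneg_left hlowj (sub_nonneg.2 hβ1.le)
    linarith

lemma tendsto_count_atTop {p : ℕ → Prop} [DecidablePred p] (hp : ∃ᶠ k in atTop, p k) :
    Tendsto (Nat.count p) atTop atTop :=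
  tendsto_atTop_atTop_of_monotone (Nat.count_monotone p) fun b =>
    ⟨Nat.nth p b, (Nat.count_nth_of_infinite (Nat.frequently_atTop_iff_infinite.1 hp) b).ge⟩

lemma eq_pow_count_mul {p : ℕ → Prop} [DecidablePred p] {a : ℕ → ℝ} {q : ℝ}
    (hp : ∀ k, p k → a (k + 1) = q * a k) (hnp : ∀ k, ¬ p k → a (k + 1) = a k) (k : ℕ) :
    a k = q ^ Nat.count p k * a 0 := by
  induction k with
  | zero => simp
  | succ k ih =>
    by_cases h : p k
    · rw [hp k h, ih, Nat.count_succ, if_pos h]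
      ring
    · rw [hnp k h, ih, Nat.count_succ, if_neg h, add_zero]

/-- Theorem 5.5: for the IRG method with backtracking stepsizes and `θ < μ`, if
`ρ_k → 0`, `xbar` is an accumulation point of `{x^k}`, and `f` satisfies the KL
property at `xbar`, then `xbar` is a stationary point of `f` and `x^k → xbar`. -/
theorem stmt18 {n : ℕ} (f : EuclideanSpace ℝ (Fin n) → ℝ) (hf : ContDiff ℝ 1 f)
    (x g d : ℕ → EuclideanSpace ℝ (Fin n)) (ε r ρ t : ℕ → ℝ) (μ θ β γ τ : ℝ)
    (hirg : IRGScheme f x g d ε r ρ t μ θ)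
    (hbt : BacktrackingStepsize f x d t β γ τ)
    (hθμ : θ < μ)
    (hρ : Tendsto ρ atTop (nhds 0))
    (xbar : EuclideanSpace ℝ (Fin n))
    (hacc : ∃ φ : ℕ → ℕ, StrictMono φ ∧ Tendsto (x ∘ φ) atTop (nhds xbar))
    (hKL : KLProperty f xbar) :
    gradient f xbar = 0 ∧ Tendsto x atTop (nhds xbar) := by
  classical
  obtain ⟨⟨hμ0, hμ1⟩, ⟨hθ0, hθ1⟩, hε, hr, -, ht, herr, hnull, hstep, hx⟩ := hirg
  obtain ⟨⟨hβ0, hβ1⟩, ⟨hγ0, -⟩, -, -, hls⟩ := hbt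
  obtain ⟨κ, hκ, hacc⟩ := hacc
  obtain ⟨η, hη, U, hU, ψ, hψpos, hψmono, hψint, hψ⟩ := hKL
  set p : ℕ → Prop := fun k => ‖g k‖ ≤ r k + ε k
  have hcont := continuous_gradient_of_contDiff hf
  have herr' : ∀ k, ‖g k - gradient f (x k)‖ ≤ ε k := fun k => (herr k).trans (min_le_left _ _)
  have hd : ∀ k, ¬ p k → ‖d k‖ = ‖g k‖ - ε k ∧
      inner ℝ (gradient f (x k)) (d k) ≤ -‖d k‖ ^ 2 ∧
      ‖gradient f (x k)‖ ≤ ‖d k‖ + 2 * ε k := fun k hk =>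
    reduced_direction_bounds (hε k) (herr' k) (by linarith [hr k, not_le.1 hk])
      (hstep k (not_le.1 hk)).2.2
  have hrd : ∀ k, ¬ p k → r k < ‖d k‖ := fun k hk => by
    rw [(hd k hk).1]
    linarith [not_le.1 hk]
  have hdir : ∀ k, inner ℝ (gradient f (x k)) (d k) ≤ -‖d k‖ ^ 2 := by
    intro k
    by_cases hk : p k
    · simp [(hnull k hk).2.2]
    · exact (hd k hk).2.1
  have hdx : ∀ k, ‖x (k + 1) - x k‖ = t k * ‖d k‖ := fun k => by
    rw [hx k, add_sub_cancel_left, norm_smul, Real.norm_of_nonneg (ht k).le]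
  have hdec : ∀ k, β * ‖d k‖ * (t k * ‖d k‖) ≤ f (x k) - f (x (k + 1)) := by
    intro k
    by_cases hk : d k = 0
    · simp [hx k, hk]
    · obtain ⟨m, htm, hm, -⟩ := hls k hk
      rw [← htm, ← hx k] at hm
      linarith
  have hanti : Antitone fun k => f (x k) := antitone_nat_of_succ_le fun k => by
    have h0 : 0 ≤ β * ‖d k‖ * (t k * ‖d k‖) := by
      have := ht k
      positivity
    linarith [hdec k]
  have hlim : Tendsto (fun k => f (x k)) atTop (nhds (f xbar)) :=
    (tendsto_iff_tendsto_subseq_of_antitone hanti hκ.tendsto_atTop).2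
      ((hf.continuous.tendsto xbar).comp hacc)
  have hgap : Tendsto (fun k => f (x k) - f (x (k + 1))) atTop (nhds 0) := by
    simpa using hlim.sub (hlim.comp (tendsto_add_atTop_nat 1))
  have hfreq : ∃ᶠ k in atTop, p k := by
    intro hev
    obtain ⟨K, hK⟩ := eventually_atTop.1 hev
    have hconst : ∀ k ≥ K, r k = r K := by
      intro k hk
      induction k, hk using Nat.le_induction with
      | base => rfl
      | succ k hk ih => rw [(hstep k (not_le.1 (hK k hk))).1, ih]
    refine not_eventually_le_norm_direction hf hβ0 hβ1 hγ0 (hr K) ht hdir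
      (fun k hk => (hls k hk).imp fun m hm => ⟨hm.1, hm.2.2⟩) hdec hgap hκ hacc ?_
    filter_upwards [eventually_ge_atTop K] with k hk
    exact hconst k hk ▸ (hrd k (hK k hk)).le
  have hrk := eq_pow_count_mul (p := p) (fun k hk => (hnull k hk).1)
    fun k hk => (hstep k (not_le.1 hk)).1
  have hεk := eq_pow_count_mul (p := p) (fun k hk => (hnull k hk).2.1)
    fun k hk => (hstep k (not_le.1 hk)).2.1
  have hcount := tendsto_count_atTop hfreq
  have hr0 : Tendsto r atTop (nhds 0) := by
    have h := ((tendsto_pow_atTop_nhds_zero_of_lt_one hμ0.le hμ1).comp hcount).mul_const (r 0)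
    rw [zero_mul] at h
    exact h.congr fun k => (hrk k).symm
  have hεr : ∀ᶠ k in atTop, ε k ≤ r k := by
    have h := (tendsto_pow_atTop_nhds_zero_of_lt_one (div_pos hθ0 hμ0).le
      ((div_lt_one hμ0).2 hθμ)).comp hcount
    filter_upwards [h.eventually_lt_const (div_pos (hr 0) (hε 0))] with k hk
    rw [Function.comp_apply, div_pow, div_lt_div_iff₀ (pow_pos hμ0 _) (hε 0)] at hk
    rw [hrk k, hεk k]
    linarith
  have hxlim : Tendsto x atTop (nhds xbar) := by
    by_cases hreach : ∃ K, f (x K) = f xbar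
    · obtain ⟨K, hK⟩ := hreach
      have hfK : ∀ k ≥ K, f (x k) = f xbar := fun k hk =>
        le_antisymm (hK ▸ hanti hk) (hanti.le_of_tendsto hlim k)
      have hxK : ∀ k ≥ K, x k = x K := by
        intro k hk
        induction k, hk using Nat.le_induction with
        | base => rfl
        | succ k hk ih =>
          have h1 := hdec k
          rw [hfK k hk, hfK (k + 1) (hk.trans k.le_succ), sub_self] at h1
          have h2 : d k = 0 := by
            by_contra h
            have := norm_pos_iff.2 h
            have := ht k
            have : 0 < β * ‖d k‖ * (t k * ‖d k‖) := by positivity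
            linarith
          rw [hx k, h2, smul_zero, add_zero, ih]
      have hxconst : Tendsto x atTop (nhds (x K)) :=
        tendsto_const_nhds.congr' ((eventually_ge_atTop K).mono fun k hk => (hxK k hk).symm)
      rwa [tendsto_nhds_unique hacc (hxconst.comp hκ.tendsto_atTop)]
    · push Not at hreach
      have hpos : ∀ k, 0 < f (x k) - f xbar := fun k =>
        sub_pos.2 (lt_of_le_of_ne (hanti.le_of_tendsto hlim k) (hreach k).symm)
      obtain ⟨δ, hδ, hball⟩ := Metric.mem_nhds_iff.1 hU
      refine tendsto_of_kl_of_descent (Δ := fun k => f (x k) - f xbar)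
        (G := fun k => ‖gradient f (x k)‖) hη hδ (by positivity : 0 < β / 3) hψpos hψmono hψint
        hpos (fun a b hab => sub_le_sub_right (hanti hab) _)
        (by simpa using hlim.sub_const (f xbar))
        (fun k hk hkη => hψ _ (hball hk) (sub_pos.1 (hpos k)) (by linarith)) ?_ hκ hacc
      filter_upwards [hεr] with k hk
      rw [sub_sub_sub_cancel_right, hdx]
      refine le_trans ?_ (hdec k)
      have hG : p k ∨ ‖gradient f (x k)‖ ≤ 3 * ‖d k‖ := by
        refine or_iff_not_imp_left.2 fun hpk => ?_
        linarith [(hd k hpk).2.2, hrd k hpk]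
      rcases hG with hpk | hG
      · simp [(hnull k hpk).2.2]
      · refine mul_le_mul_of_nonneg_right ?_ (mul_nonneg (ht k).le (norm_nonneg _))
        linarith [mul_le_mul_of_nonneg_left hG hβ0.le]
  refine ⟨norm_le_zero_iff.1 (le_of_tendsto_of_tendsto_of_frequently
    ((hcont.tendsto xbar).comp hxlim).norm (by simpa using hr0.const_mul 4) ?_), hxlim⟩
  refine (hfreq.and_eventually hεr).mono fun k ⟨hpk, hk⟩ => ?_
  change ‖gradient f (x k)‖ ≤ 4 * r k
  have hpk' : ‖g k‖ ≤ r k + ε k := hpk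
  linarith [norm_le_norm_add_norm_sub (g k) (gradient f (x k)), herr' k, hr k]
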